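/- Blockwise degree decay of the simulated Greedy (Lemma 2, safe constants). Let n ≥ 3 and let G be a finite simple graph on n vertices with maximum degree Δ ≥ 1. Then with probability at least 1 − n^{−7} over the uniformly random ordering, the following holds for every i ≥ 1 at which the block process has not yet stopped (i.e., Δ_1, …, Δ_{i−1} > (ln n)^4 whenever i ≥ 2): Δ_i ≤ Δ^{1/2^{i−1}} · 2500 · (ln n)². -/

import Mathlib

open Finset
open scoped Classical

/-- The closed neighborhood of `v` as a `Finset`. -/
def closedNbhd {V : Type*} [Fintype V] [DecidableEq V] (G : SimpleGraph V)
    [DecidableRel G.Adj] (v : V) : Finset V :=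
  insert v (G.neighborFinset v)

/-- One pass of the sequential greedy MIS process over a list of vertices, carrying
the pair `(I, U)` of the current independent set and the current uncovered set. -/
def greedyStep {V : Type*} [Fintype V] [DecidableEq V] (G : SimpleGraph V)
    [DecidableRel G.Adj] : Finset V × Finset V → List V → Finset V × Finset V
  | p, [] => p
  | p, v :: rest =>
      greedyStep G (if v ∈ p.2 then (insert v p.1, p.2 \ closedNbhd G v) else p) rest

/-- `greedyU G σ t` is `U_t`: the set of uncovered vertices at the beginning of
iteration `t` (i.e. after the greedy process has handled `v_1, …, v_{t-1}`). -/
def greedyU {V : Type*} [Fintype V] [DecidableEq V] (G : SimpleGraph V)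
    [DecidableRel G.Adj] {n : ℕ} (σ : Fin n ≃ V) (t : ℕ) : Finset V :=
  (greedyStep G (∅, Finset.univ) ((List.ofFn ⇑σ).take (t - 1))).2

/-- Maximum degree of the subgraph of `G` induced by the vertex set `S`. -/
def maxDegOn {V : Type*} [Fintype V] [DecidableEq V] (G : SimpleGraph V)
    [DecidableRel G.Adj] (S : Finset V) : ℕ :=
  S.sup fun v => (G.neighborFinset v ∩ S).card

/-- `blockK G σ i` is `k_i`, the number of vertices processed after `i` blocks of
the simulated greedy process (with parameter `C = 5`): `k_0 = 0` and, as long as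
the current residual maximum degree `Δ_i` exceeds `(ln n)^4`,
`k_i = ⌈n / (5·√Δ_i)⌉`; once `Δ_i ≤ (ln n)^4` the process stops (`k` freezes). -/
noncomputable def blockK {V : Type*} [Fintype V] [DecidableEq V] (G : SimpleGraph V)
    [DecidableRel G.Adj] {n : ℕ} (σ : Fin n ≃ V) : ℕ → ℕ
  | 0 => 0
  | i + 1 =>
      let D := maxDegOn G (greedyU G σ (blockK G σ i + 1))
      if (Real.log n) ^ 4 < (D : ℝ) then ⌈(n : ℝ) / (5 * Real.sqrt D)⌉₊
      else blockK G σ i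

/-- `blockDelta G σ i` is `Δ_i`, the maximum degree of the residual graph at the
beginning of block `i`, i.e. after greedy has processed the first `k_{i-1}`
vertices. -/
noncomputable def blockDelta {V : Type*} [Fintype V] [DecidableEq V] (G : SimpleGraph V)
    [DecidableRel G.Adj] {n : ℕ} (σ : Fin n ≃ V) (i : ℕ) : ℕ :=
  maxDegOn G (greedyU G σ (blockK G σ (i - 1) + 1))

section Greedy

variable {V : Type*} [Fintype V] [DecidableEq V] (G : SimpleGraph V) [DecidableRel G.Adj]

theorem greedyStep_append (p : Finset V × Finset V) (l₁ l₂ : List V) :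
    greedyStep G p (l₁ ++ l₂) = greedyStep G (greedyStep G p l₁) l₂ := by
  induction l₁ generalizing p with
  | nil => rfl
  | cons v l ih => exact ih _

theorem greedyU_succ {n : ℕ} (σ : Fin n ≃ V) (k : Fin n) :
    greedyU G σ (k + 2) =
      if σ k ∈ greedyU G σ (k + 1) then greedyU G σ (k + 1) \ closedNbhd G (σ k)
      else greedyU G σ (k + 1) := by
  have htake : (List.ofFn ⇑σ).take (k + 2 - 1) =
      (List.ofFn ⇑σ).take (k + 1 - 1) ++ [σ k] := by
    have h : (k : ℕ) < (List.ofFn ⇑σ).length := by simp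
    simp only [Nat.add_sub_cancel, show (k : ℕ) + 2 - 1 = k + 1 from rfl]
    rw [List.take_add_one, List.getElem?_eq_getElem h]
    simp
  simp only [greedyU, htake, greedyStep_append, greedyStep]
  by_cases h : σ k ∈ (greedyStep G (∅, univ) ((List.ofFn ⇑σ).take (k + 1 - 1))).2
  · exact (congrArg Prod.snd (if_pos h)).trans (if_pos h).symm
  · exact (congrArg Prod.snd (if_neg h)).trans (if_neg h).symm

theorem greedyU_succ_subset {n : ℕ} (σ : Fin n ≃ V) (k : Fin n) :
    greedyU G σ (k + 2) ⊆ greedyU G σ (k + 1) := by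
  rw [greedyU_succ]
  split_ifs
  · exact sdiff_subset
  · exact Subset.rfl

/-- Processed vertices are covered. -/
theorem notMem_greedyU {n : ℕ} (σ : Fin n ≃ V) {k : ℕ} (hk : k ≤ n) {j : Fin n}
    (hj : (j : ℕ) < k) : σ j ∉ greedyU G σ (k + 1) := by
  induction k with
  | zero => omega
  | succ k ih =>
    intro hmem
    rcases Nat.lt_succ_iff_lt_or_eq.mp hj with h | h
    · exact ih (by omega) h (greedyU_succ_subset G σ ⟨k, hk⟩ hmem)
    · obtain rfl : j = ⟨k, hk⟩ := Fin.ext h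
      have hs := greedyU_succ G σ ⟨k, hk⟩
      simp only [] at hs
      rw [show k + 1 + 1 = k + 2 from rfl, hs] at hmem
      split_ifs at hmem with hc
      · simp [closedNbhd] at hmem
      · exact hc hmem

/-- The uncovered set after `k` steps depends only on the first `k` vertices. -/
theorem greedyU_congr {n : ℕ} {σ τ : Fin n ≃ V} {k : ℕ} (hk : k ≤ n)
    (h : ∀ i : Fin n, (i : ℕ) < k → σ i = τ i) :
    greedyU G σ (k + 1) = greedyU G τ (k + 1) := by
  induction k with
  | zero => rfl
  | succ k ih =>
    have hs := greedyU_succ G σ ⟨k, hk⟩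
    have ht := greedyU_succ G τ ⟨k, hk⟩
    simp only [] at hs ht
    rw [show k + 1 + 1 = k + 2 from rfl, hs, ht, ih (by omega) fun i hi => h i (by omega),
      h ⟨k, hk⟩ (Nat.lt_succ_self k)]

/-- Orderings for which `v` is uncovered with residual degree above `T` after `k` steps. -/
noncomputable def highDegOrderings (n : ℕ) (v : V) (T : ℝ) (k : ℕ) : Finset (Fin n ≃ V) :=
  univ.filter fun σ => v ∈ greedyU G σ (k + 1) ∧
    T < ((G.neighborFinset v ∩ greedyU G σ (k + 1)).card : ℝ)

theorem highDegOrderings_succ_subset {n : ℕ} (v : V) (T : ℝ) (k : Fin n) :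
    highDegOrderings G n v T (k + 1) ⊆ (highDegOrderings G n v T k).filter
      fun σ => σ k ∉ G.neighborFinset v ∩ greedyU G σ (k + 1) := by
  intro σ hσ
  simp only [highDegOrderings, mem_filter, mem_univ, true_and] at hσ ⊢
  obtain ⟨hv, hT⟩ := hσ
  have hsub := greedyU_succ_subset G σ k
  refine ⟨⟨hsub hv, hT.trans_le ?_⟩, fun hk => ?_⟩
  · exact_mod_cast card_le_card (inter_subset_inter_left hsub)
  · rw [mem_inter, SimpleGraph.mem_neighborFinset] at hk
    rw [show (k : ℕ) + 1 + 1 = k + 2 from rfl, greedyU_succ, if_pos hk.2] at hv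
    simp [closedNbhd, hk.1.symm] at hv

/-- Each position `j ≥ k` is equally likely to hold an uncovered neighbor of `v`. -/
theorem card_filter_neighbor_eq {n : ℕ} (v : V) (T : ℝ) {k j : Fin n} (hkj : k ≤ j) :
    ((highDegOrderings G n v T k).filter
      fun σ => σ j ∈ G.neighborFinset v ∩ greedyU G σ (k + 1)).card =
    ((highDegOrderings G n v T k).filter
      fun σ => σ k ∈ G.neighborFinset v ∩ greedyU G σ (k + 1)).card := by
  have hU (σ : Fin n ≃ V) :
      greedyU G ((Equiv.swap k j).trans σ) (k + 1) = greedyU G σ (k + 1) := by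
    refine greedyU_congr G k.2.le fun i hi => ?_
    have hik : i ≠ k := by rintro rfl; exact lt_irrefl _ hi
    have hij : i ≠ j := by
      rintro rfl
      exact absurd hi (not_lt.mpr hkj)
    simp [Equiv.swap_apply_of_ne_of_ne hik hij]
  have hinv (σ : Fin n ≃ V) : (Equiv.swap k j).trans ((Equiv.swap k j).trans σ) = σ := by
    ext x; simp
  refine card_nbij' (fun σ => (Equiv.swap k j).trans σ) (fun σ => (Equiv.swap k j).trans σ)
    ?_ ?_ (fun σ _ => hinv σ) (fun σ _ => hinv σ)
  all_goals
    intro σ hσ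
    simpa [highDegOrderings, hU] using hσ

theorem card_highDegOrderings_succ_le {n : ℕ} (v : V) {T : ℝ} (k : Fin n) :
    (n : ℝ) * (highDegOrderings G n v T (k + 1)).card ≤
      (n - T) * (highDegOrderings G n v T k).card := by
  set B := highDegOrderings G n v T k
  set P : (Fin n ≃ V) → Fin n → Prop :=
    fun σ j => σ j ∈ G.neighborFinset v ∩ greedyU G σ (k + 1) with hP
  have hcount : T * B.card ≤ n * (B.filter fun σ => P σ k).card := by
    calc T * B.card = ∑ σ ∈ B, T := by rw [sum_const, nsmul_eq_mul, mul_comm]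
      _ ≤ ∑ σ ∈ B, (((univ.filter fun j => k ≤ j ∧ P σ j).card : ℕ) : ℝ) := by
        refine sum_le_sum fun σ hσ => ?_
        have hσ' := (mem_filter.mp hσ).2.2.le
        refine hσ'.trans ?_
        norm_cast
        refine card_le_card_of_injOn σ.symm (fun u hu => ?_) σ.symm.injective.injOn
        have hu' := (mem_inter.mp hu).2
        simp only [coe_filter, mem_univ, true_and, Set.mem_ofPred_eq, hP,
          Equiv.apply_symm_apply]
        refine ⟨?_, hu⟩
        by_contra hlt
        refine notMem_greedyU G σ k.2.le (j := σ.symm u) (not_le.mp hlt) ?_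
        simpa using hu'
      _ = ((∑ σ ∈ B, (univ.filter fun j => k ≤ j ∧ P σ j).card : ℕ) : ℝ) := by push_cast; rfl
      _ = ((∑ j ∈ univ.filter (fun j => k ≤ j), (B.filter fun σ => P σ j).card : ℕ) : ℝ) := by
        congr 1
        simp only [← filter_filter]
        exact sum_card_bipartiteAbove_eq_sum_card_bipartiteBelow P
      _ = ((∑ j ∈ univ.filter (fun j => k ≤ j), (B.filter fun σ => P σ k).card : ℕ) : ℝ) := by
        congr 1
        exact sum_congr rfl fun j hj => card_filter_neighbor_eq G v T (mem_filter.mp hj).2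
      _ ≤ n * (B.filter fun σ => P σ k).card := by
        rw [sum_const, smul_eq_mul]
        norm_cast
        gcongr
        simpa using card_filter_le (univ : Finset (Fin n)) (fun j => k ≤ j)
  have hsub : ((highDegOrderings G n v T (k + 1)).card : ℝ) ≤
      (B.filter fun σ => ¬ P σ k).card := by
    exact_mod_cast card_le_card (highDegOrderings_succ_subset G v T k)
  have hsplit : ((B.filter fun σ => P σ k).card : ℝ) + (B.filter fun σ => ¬ P σ k).card =
      B.card := by
    exact_mod_cast card_filter_add_card_filter_not (s := B) (fun σ => P σ k)
  have hmul := mul_le_mul_of_nonneg_left hsub (Nat.cast_nonneg (α := ℝ) n)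
  rw [← hsplit] at hcount ⊢
  nlinarith

theorem card_highDegOrderings_le {n : ℕ} (v : V) (T : ℝ) {k : ℕ} (hk : k ≤ n) :
    ((highDegOrderings G n v T k).card : ℝ) ≤
      Real.exp (-(k * T / n)) * Fintype.card (Fin n ≃ V) := by
  induction k with
  | zero =>
    simp only [Nat.cast_zero, zero_mul, zero_div, neg_zero, Real.exp_zero, one_mul]
    exact_mod_cast card_le_univ _
  | succ k ih =>
    have hn : (0 : ℝ) < n := by exact_mod_cast (by omega : 0 < n)
    have hstep := card_highDegOrderings_succ_le G v (T := T) (⟨k, hk⟩ : Fin n)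
    simp only [] at hstep
    have hfac : (n : ℝ) - T ≤ n * Real.exp (-(T / n)) := by
      have h := mul_le_mul_of_nonneg_left (Real.add_one_le_exp (-(T / n))) hn.le
      have h' : (n : ℝ) * (-(T / n) + 1) = n - T := by field_simp; ring
      linarith
    have hexp : Real.exp (-(((k + 1 : ℕ) : ℝ) * T / n)) =
        Real.exp (-(T / n)) * Real.exp (-(k * T / n)) := by
      rw [← Real.exp_add]
      congr 1
      push_cast
      ring
    refine le_of_mul_le_mul_left ?_ hn
    calc (n : ℝ) * (highDegOrderings G n v T (k + 1)).card
        ≤ (n - T) * (highDegOrderings G n v T k).card := hstep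
      _ ≤ n * Real.exp (-(T / n)) * (highDegOrderings G n v T k).card := by gcongr
      _ ≤ n * Real.exp (-(T / n)) *
          (Real.exp (-(k * T / n)) * Fintype.card (Fin n ≃ V)) := by
        gcongr
        exact ih (by omega)
      _ = _ := by rw [hexp]; ring

theorem maxDegOn_le_of_notMem_highDegOrderings {n k : ℕ} {T : ℝ} (hT : 0 ≤ T)
    {σ : Fin n ≃ V} (h : ∀ v, σ ∉ highDegOrderings G n v T k) :
    (maxDegOn G (greedyU G σ (k + 1)) : ℝ) ≤ T := by
  refine (Nat.cast_le.mpr (Finset.sup_le fun v hv => Nat.le_floor ?_)).trans (Nat.floor_le hT)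
  by_contra hlt
  exact h v (mem_filter.mpr ⟨mem_univ _, hv, not_le.mp hlt⟩)

theorem one_lt_log_natCast {n : ℕ} (hn : 3 ≤ n) : 1 < Real.log n := by
  rw [Real.lt_log_iff_exp_lt (by positivity)]
  have h3 : (3 : ℝ) ≤ n := by exact_mod_cast hn
  linarith [Real.exp_one_lt_d9]

/-- If the residual degree after every `k ∈ [1, n]` steps is at most `10 n ln n / k`, then the
degrees at the beginning of the blocks decay doubly exponentially. -/
theorem blockDelta_succ_le {n : ℕ} (hn : 3 ≤ n) {σ : Fin n ≃ V}
    (hσ : ∀ k, 1 ≤ k → k ≤ n →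
      (maxDegOn G (greedyU G σ (k + 1)) : ℝ) ≤ 10 * n * Real.log n / k)
    (i : ℕ) (hi : ∀ j, j < i → (Real.log n) ^ 4 < (blockDelta G σ (j + 1) : ℝ)) :
    (blockDelta G σ (i + 1) : ℝ) ≤
      (maxDegOn G univ : ℝ) ^ ((1 : ℝ) / 2 ^ i) * 2500 * (Real.log n) ^ 2 := by
  have hlog := one_lt_log_natCast hn
  have hn0 : (0 : ℝ) < n := by positivity
  induction i with
  | zero =>
    have h1 : blockDelta G σ (0 + 1) = maxDegOn G univ := rfl
    rw [h1]
    simp only [pow_zero, div_one, Real.rpow_one, mul_assoc]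
    exact le_mul_of_one_le_right (Nat.cast_nonneg _) (by nlinarith)
  | succ i ih =>
    have ih := ih fun j hj => hi j (by omega)
    have hD := hi i (Nat.lt_succ_self i)
    set D : ℕ := blockDelta G σ (i + 1)
    have hblock : blockK G σ (i + 1) = ⌈(n : ℝ) / (5 * Real.sqrt D)⌉₊ := by
      rw [blockK]
      exact if_pos hD
    set k := ⌈(n : ℝ) / (5 * Real.sqrt D)⌉₊
    have hD1 : (1 : ℝ) < D := (one_lt_pow₀ hlog (by norm_num)).trans hD
    have hs1 : 1 ≤ Real.sqrt D := Real.one_le_sqrt.mpr hD1.le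
    have hs0 : 0 < Real.sqrt D := by linarith
    have hle : (n : ℝ) / (5 * Real.sqrt D) ≤ k := Nat.le_ceil _
    have hk1 : 1 ≤ k := Nat.ceil_pos.mpr (by positivity)
    have hkn : k ≤ n := Nat.ceil_le.mpr (div_le_self hn0.le (by linarith))
    have hk0 : (0 : ℝ) < k := by exact_mod_cast hk1
    have hnext : (blockDelta G σ (i + 1 + 1) : ℝ) ≤ 50 * Real.sqrt D * Real.log n := by
      have h := hσ k hk1 hkn
      rw [← hblock] at h
      refine h.trans ?_
      rw [hblock, div_le_iff₀ hk0]
      rw [div_le_iff₀ (by positivity)] at hle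
      nlinarith
    have hsqrt : Real.sqrt D ≤
        (maxDegOn G univ : ℝ) ^ ((1 : ℝ) / 2 ^ (i + 1)) * (50 * Real.log n) := by
      refine Real.sqrt_le_iff.mpr ⟨by positivity, ih.trans_eq ?_⟩
      rw [mul_pow, ← Real.rpow_natCast (_ ^ _), ← Real.rpow_mul (Nat.cast_nonneg _),
        show (1 : ℝ) / 2 ^ (i + 1) * ((2 : ℕ) : ℝ) = 1 / 2 ^ i by
          push_cast; field_simp; ring]
      ring
    calc (blockDelta G σ (i + 1 + 1) : ℝ) ≤ 50 * Real.sqrt D * Real.log n := hnext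
      _ ≤ 50 * ((maxDegOn G univ : ℝ) ^ ((1 : ℝ) / 2 ^ (i + 1)) * (50 * Real.log n)) *
          Real.log n := by gcongr
      _ = _ := by ring

/-- Orderings violating the residual degree bound `10 n ln n / k` after some `k ∈ [1, n]` steps. -/
noncomputable def badOrderings (n : ℕ) : Finset (Fin n ≃ V) :=
  (Icc 1 n ×ˢ (univ : Finset V)).biUnion fun p =>
    highDegOrderings G n p.2 (10 * n * Real.log n / p.1) p.1

theorem card_badOrderings_le {n : ℕ} (hn : 3 ≤ n) (hcard : Fintype.card V = n) :
    ((badOrderings G n).card : ℝ) ≤ (n : ℝ) ^ (-7 : ℤ) * Fintype.card (Fin n ≃ V) := by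
  have hn0 : (0 : ℝ) < n := by positivity
  have hterm : ∀ p ∈ Icc 1 n ×ˢ (univ : Finset V),
      ((highDegOrderings G n p.2 (10 * n * Real.log n / p.1) p.1).card : ℝ) ≤
        (n : ℝ) ^ (-10 : ℤ) * Fintype.card (Fin n ≃ V) := by
    intro p hp
    obtain ⟨h1, h2⟩ := mem_Icc.mp (mem_product.mp hp).1
    have hp0 : (0 : ℝ) < p.1 := by exact_mod_cast h1
    refine (card_highDegOrderings_le G p.2 _ h2).trans_eq ?_
    congr 1
    rw [show -((p.1 : ℝ) * (10 * n * Real.log n / p.1) / n) = Real.log n * ((-10 : ℤ) : ℝ) by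
      push_cast; field_simp, Real.exp_mul, Real.exp_log hn0, Real.rpow_intCast]
  calc ((badOrderings G n).card : ℝ)
      ≤ ∑ p ∈ Icc 1 n ×ˢ (univ : Finset V),
          ((highDegOrderings G n p.2 (10 * n * Real.log n / p.1) p.1).card : ℝ) := by
        rw [← Nat.cast_sum]
        exact Nat.cast_le.mpr card_biUnion_le
    _ ≤ ∑ p ∈ Icc 1 n ×ˢ (univ : Finset V),
          (n : ℝ) ^ (-10 : ℤ) * Fintype.card (Fin n ≃ V) := sum_le_sum hterm
    _ = (n : ℝ) ^ (-8 : ℤ) * Fintype.card (Fin n ≃ V) := by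
        rw [sum_const, card_product, Nat.card_Icc, card_univ, hcard, nsmul_eq_mul,
          Nat.add_sub_cancel, ← mul_assoc]
        congr 1
        push_cast
        rw [← sq, ← zpow_natCast, ← zpow_add₀ hn0.ne']
        norm_num
    _ ≤ _ := by
        gcongr
        · exact_mod_cast (by omega : 1 ≤ n)
        · norm_num

end Greedy

/-- **Blockwise degree decay of the simulated Greedy.** With probability at least
`1 - n ^ (-7)` over a uniformly random ordering: for every block `i ≥ 1` at which
the process has not yet stopped (i.e. `Δ_j > (ln n)^4` for all `1 ≤ j < i`),
`Δ_i ≤ Δ^(1/2^(i-1)) · 2500 · (ln n)²`. -/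
theorem blockwise_degree_decay
    {V : Type*} [Fintype V] [DecidableEq V] {n : ℕ} (hn : 3 ≤ n)
    (hcard : Fintype.card V = n)
    (G : SimpleGraph V) [DecidableRel G.Adj]
    (hΔ : 1 ≤ maxDegOn G Finset.univ) :
    (1 - (n : ℝ) ^ (-7 : ℤ)) * (Fintype.card (Fin n ≃ V) : ℝ) ≤
      ((Finset.univ.filter (fun σ : Fin n ≃ V =>
        ∀ i, 1 ≤ i →
          (∀ j, 1 ≤ j → j < i → (Real.log n) ^ 4 < (blockDelta G σ j : ℝ)) →
          (blockDelta G σ i : ℝ) ≤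
            (maxDegOn G Finset.univ : ℝ) ^ ((1 : ℝ) / 2 ^ (i - 1)) *
              2500 * (Real.log n) ^ 2)).card : ℝ) := by
  have hgood : (badOrderings G n)ᶜ ⊆ univ.filter (fun σ : Fin n ≃ V =>
      ∀ i, 1 ≤ i →
        (∀ j, 1 ≤ j → j < i → (Real.log n) ^ 4 < (blockDelta G σ j : ℝ)) →
        (blockDelta G σ i : ℝ) ≤
          (maxDegOn G Finset.univ : ℝ) ^ ((1 : ℝ) / 2 ^ (i - 1)) *
            2500 * (Real.log n) ^ 2) := by
    intro σ hσ
    refine mem_filter.mpr ⟨mem_univ _, fun i hi hlarge => ?_⟩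
    obtain ⟨i, rfl⟩ := Nat.exists_eq_add_of_le' hi
    refine blockDelta_succ_le G hn (fun k hk1 hkn => ?_) i
      fun j hj => hlarge (j + 1) (by omega) (by omega)
    have hlog := one_lt_log_natCast hn
    refine maxDegOn_le_of_notMem_highDegOrderings G (by positivity) fun v hv => ?_
    exact mem_compl.mp hσ
      (mem_biUnion.mpr ⟨(k, v), by simp [hk1, hkn], hv⟩)
  have hcompl : ((badOrderings G n).card : ℝ) + ((badOrderings G n)ᶜ.card : ℝ) =
      Fintype.card (Fin n ≃ V) := by
    exact_mod_cast card_add_card_compl (badOrderings G n)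
  have hle : ((badOrderings G n)ᶜ.card : ℝ) ≤ _ := Nat.cast_le.mpr (card_le_card hgood)
  have hbad := card_badOrderings_le G hn hcard
  linarith
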